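/- arXiv:1907.12387 — 2 statements merged into one kernel-verified Lean document; each statement's English description precedes it below -/
import Mathlib

section
/- Let R be a commutative integral domain and M a finitely generated R-module. Let ε : M → Hom_R(Hom_R(M,R),R) be the canonical evaluation map, ε(m)(f) = f(m). Then the kernel of ε equals the torsion submodule t(M) = {m ∈ M | ∃ r ∈ R, r ≠ 0, r·m = 0}. In particular, ε is injective if and only if M is torsion-free. -/
/-- For a finitely generated module `M` over a commutative integral domain `R`,
the kernel of the canonical evaluation map `ε : M → Hom_R(Hom_R(M,R),R)`,
`ε(m)(f) = f(m)`, equals the torsion submodule of `M`; in particular `ε` is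
injective if and only if `M` is torsion-free. -/
theorem ker_dual_eval_eq_torsion (R : Type*) [CommRing R] [IsDomain R]
    (M : Type*) [AddCommGroup M] [Module R M] [Module.Finite R M] :
    LinearMap.ker (Module.Dual.eval R M) = Submodule.torsion R M ∧
      (Function.Injective (Module.Dual.eval R M) ↔ Submodule.torsion R M = ⊥) := by
  have key : LinearMap.ker (Module.Dual.eval R M) = Submodule.torsion R M := by
    apply le_antisymm
    · intro m hm
      have hm' : ∀ f : M →ₗ[R] R, f m = 0 := fun f => by
        have := congrArg (fun g => g f) (LinearMap.mem_ker.1 hm)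
        simpa using this
      rw [Submodule.mem_torsion_iff]
      by_contra hcon
      let ι := LocalizedModule.mkLinearMap (nonZeroDivisors R) M
      have hι : ι m ≠ 0 := fun h =>
        hcon ((IsLocalizedModule.eq_zero_iff (nonZeroDivisors R) ι).1 h)
      obtain ⟨φ, hφ⟩ : ∃ φ : Module.Dual (FractionRing R)
          (LocalizedModule (nonZeroDivisors R) M), φ (ι m) ≠ 0 := by
        by_contra! h
        exact hι ((Module.forall_dual_apply_eq_zero_iff (FractionRing R) _).1 h)
      let g : M →ₗ[R] FractionRing R := (φ.restrictScalars R).comp ι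
      obtain ⟨S, hS⟩ := (Module.Finite.fg_top : (⊤ : Submodule R M).FG)
      obtain ⟨b, hb⟩ := IsLocalization.exist_integer_multiples (nonZeroDivisors R) S
        (fun x => g x)
      let A := Algebra.linearMap R (FractionRing R)
      have hA : Function.Injective A := IsFractionRing.injective R (FractionRing R)
      have hr : ∀ x, ((b : R) • g) x ∈ LinearMap.range A := by
        have : (⊤ : Submodule R M) ≤ (LinearMap.range A).comap ((b : R) • g) := by
          rw [← hS, Submodule.span_le]
          intro x hx
          obtain ⟨y, hy⟩ := hb x hx
          exact ⟨y, hy⟩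
        exact fun x => this trivial
      let f : M →ₗ[R] R := (LinearEquiv.ofInjective A hA).symm.toLinearMap.comp
        (((b : R) • g).codRestrict _ hr)
      have h1 : A (f m) = (b : R) • g m := by
        have := (LinearEquiv.ofInjective A hA).apply_symm_apply
          (((b : R) • g).codRestrict _ hr m)
        exact congrArg Subtype.val this
      rw [hm' f, map_zero, eq_comm, Algebra.smul_def] at h1
      rcases mul_eq_zero.1 h1 with h | h
      · exact nonZeroDivisors.coe_ne_zero b (hA (h.trans (map_zero A).symm))
      · exact hφ h
    · intro m hm
      obtain ⟨a, ha⟩ := (Submodule.mem_torsion_iff m).1 hm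
      rw [LinearMap.mem_ker]
      ext f
      have h : (a : R) * f m = 0 := by
        rw [← smul_eq_mul, ← map_smul]
        exact (congrArg f ha).trans (map_zero f)
      simpa using (mul_eq_zero.1 h).resolve_left (nonZeroDivisors.coe_ne_zero a)
  exact ⟨key, by rw [← key, LinearMap.ker_eq_bot]⟩
end

section
/- Let y, u, v be smooth real functions on ℝ³ satisfying the Macaulay system ∂₃∂₃y = u and ∂₁∂₃y − ∂₂y = v. Then the two further prolongation identities hold: ∂₂∂₃y = ∂₁u − ∂₃v and ∂₂∂₂y = ∂₁∂₁u − ∂₁∂₃v − ∂₂v. -/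
/-- The partial derivative of `g : ℝ³ → ℝ` with respect to the `i`-th coordinate. -/
noncomputable def pd (i : Fin 3) (g : (Fin 3 → ℝ) → ℝ) : (Fin 3 → ℝ) → ℝ :=
  fun x => fderiv ℝ g x (Pi.single i 1)

theorem pd_smooth (i : Fin 3) {g : (Fin 3 → ℝ) → ℝ} (hg : ContDiff ℝ (⊤ : ℕ∞) g) :
    ContDiff ℝ (⊤ : ℕ∞) (pd i g) := by
  unfold pd
  exact (hg.fderiv_right (m := ((⊤ : ℕ∞) : WithTop ℕ∞)) (by simp)).clm_apply contDiff_const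

theorem pd_sub (i : Fin 3) {f g : (Fin 3 → ℝ) → ℝ} (hf : ContDiff ℝ (⊤ : ℕ∞) f)
    (hg : ContDiff ℝ (⊤ : ℕ∞) g) : pd i (f - g) = pd i f - pd i g := by
  funext x
  simp only [pd, Pi.sub_apply]
  rw [fderiv_sub (hf.differentiable (by simp) x) (hg.differentiable (by simp) x)]
  rfl

theorem pd_comm (i j : Fin 3) {g : (Fin 3 → ℝ) → ℝ} (hg : ContDiff ℝ (⊤ : ℕ∞) g) :
    pd i (pd j g) = pd j (pd i g) := by
  have hd : Differentiable ℝ (fderiv ℝ g) :=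
    (hg.fderiv_right (m := ((⊤ : ℕ∞) : WithTop ℕ∞)) (by simp)).differentiable (by simp)
  funext x
  have key : ∀ a b : Fin 3, pd a (pd b g) x
      = fderiv ℝ (fderiv ℝ g) x (Pi.single a 1) (Pi.single b 1) := by
    intro a b
    unfold pd
    rw [fderiv_clm_apply (hd x) (differentiableAt_const _)]
    simp
  rw [key, key]
  exact second_derivative_symmetric (fun z => (hg.differentiable (by simp) z).hasFDerivAt)
    (hd x).hasFDerivAt _ _

/-- If smooth `y, u, v : ℝ³ → ℝ` satisfy the Macaulay system `∂₃∂₃y = u` and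
`∂₁∂₃y − ∂₂y = v`, then the prolongation identities `∂₂∂₃y = ∂₁u − ∂₃v` and
`∂₂∂₂y = ∂₁∂₁u − ∂₁∂₃v − ∂₂v` hold. -/
theorem macaulay_prolongation (y u v : (Fin 3 → ℝ) → ℝ)
    (hy : ContDiff ℝ (⊤ : ℕ∞) y) (hu : ContDiff ℝ (⊤ : ℕ∞) u) (hv : ContDiff ℝ (⊤ : ℕ∞) v)
    (h1 : pd 2 (pd 2 y) = u)
    (h2 : pd 0 (pd 2 y) - pd 1 y = v) :
    pd 1 (pd 2 y) = pd 0 u - pd 2 v ∧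
      pd 1 (pd 1 y) = pd 0 (pd 0 u) - pd 0 (pd 2 v) - pd 1 v := by
  have s2 := pd_smooth 2 hy
  have s1 := pd_smooth 1 hy
  have s02 := pd_smooth 0 s2
  have e1 : pd 1 (pd 2 y) = pd 0 u - pd 2 v := by
    rw [← h1, ← h2, pd_sub 2 s02 s1, pd_comm 0 2 s2, pd_comm 1 2 hy]
    abel
  refine ⟨e1, ?_⟩
  rw [← pd_sub 0 (pd_smooth 0 hu) (pd_smooth 2 hv), ← e1, ← h2, pd_sub 1 s02 s1, pd_comm 0 1 s2]
  abel
end
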